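/- arXiv:2403.18545 — 8 statements merged into one kernel-verified Lean document; each statement's English description precedes it below -/
import Mathlib

section
/- Let n ≥ 2, k ≥ 2 and fix device counts m_j > 0. There is no allocation mechanism S assigning to every positive speedup matrix W a feasible allocation S(W) such that both: (i) for every W, S(W) is sharing-incentive with respect to W and attains the maximum total efficiency (with respect to W) among all feasible sharing-incentive allocations; and (ii) S is strategy-proof, i.e. for every W, every user l, and every speedup matrix W' that agrees with W outside row l and satisfies W'_l ≥ W_l componentwise, user l's true throughput does not increase: W_l · S(W')_l ≤ W_l · S(W)_l. -/
open Finset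

/-- `dotRow w x = ∑ j, w j * x j`: throughput a user with speedup row `w`
obtains from the allocation row `x`. -/
def dotRow {k : ℕ} (w x : Fin k → ℝ) : ℝ := ∑ j, w j * x j

/-- User `l`'s throughput under allocation `X` given speedup matrix `W`. -/
def throughput {n k : ℕ} (W X : Fin n → Fin k → ℝ) (l : Fin n) : ℝ := dotRow (W l) (X l)

/-- Total efficiency of allocation `X` under speedup matrix `W`. -/
def totalEff {n k : ℕ} (W X : Fin n → Fin k → ℝ) : ℝ := ∑ l, throughput W X l

/-- `X` is a feasible allocation: entrywise nonnegative and, for each GPU type `j`,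
at most `m j` devices are allocated. -/
def Feasible {n k : ℕ} (m : Fin k → ℝ) (X : Fin n → Fin k → ℝ) : Prop :=
  (∀ l j, 0 ≤ X l j) ∧ ∀ j, ∑ l, X l j ≤ m j

/-- `X` is envy-free w.r.t. `W`: no user prefers another user's allocation row. -/
def EnvyFree {n k : ℕ} (W X : Fin n → Fin k → ℝ) : Prop :=
  ∀ l i, dotRow (W l) (X i) ≤ dotRow (W l) (X l)

/-- `X` is sharing-incentive w.r.t. `W` and device counts `m`: every user gets at
least the throughput of a `1/n` share of every device type. -/
def SharingIncentive {n k : ℕ} (m : Fin k → ℝ) (W X : Fin n → Fin k → ℝ) : Prop :=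
  ∀ l, (1 / (n : ℝ)) * ∑ j, m j * W l j ≤ throughput W X l

lemma Fintype.sum_ite_eq_const {ι : Type*} [Fintype ι] [DecidableEq ι] (i : ι) (a b : ℝ) :
    ∑ j, (if j = i then a else b) = a + ((Fintype.card ι : ℝ) - 1) * b := by
  rw [← Finset.add_sum_erase univ _ (mem_univ i), if_pos rfl,
    Finset.sum_congr rfl (g := fun _ => b) fun j hj => if_neg (Finset.ne_of_mem_erase hj),
    Finset.sum_const, Finset.card_erase_of_mem (mem_univ i), nsmul_eq_mul,
    Nat.cast_sub (Finset.card_pos.mpr ⟨i, mem_univ i⟩)]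
  simp

/-- The speedup matrix in which user `l₀` values the whole stock of type `j₀` at `c * k` and of
every other type at `c`, while all other users value these stocks at `1` and `n`. -/
noncomputable def contestedSpeedup {n k : ℕ} (m : Fin k → ℝ) (l₀ : Fin n) (j₀ : Fin k) (c : ℝ) :
    Fin n → Fin k → ℝ := fun l j =>
  (if l = l₀ then (if j = j₀ then c * k else c) else (if j = j₀ then 1 else (n : ℝ))) / m j

/-- The allocation giving user `l₀` the whole stock of type `j₀`, and splitting the fraction `t`
of every other type equally among the other users, the rest going to `l₀`. -/
noncomputable def contestedAllocation {n k : ℕ} (m : Fin k → ℝ) (l₀ : Fin n) (j₀ : Fin k) (t : ℝ) :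
    Fin n → Fin k → ℝ := fun l j =>
  m j * (if l = l₀ then (if j = j₀ then 1 else 1 - t)
    else (if j = j₀ then 0 else t / ((n : ℝ) - 1)))

section Contested

variable {n k : ℕ} {m : Fin k → ℝ} {l₀ : Fin n} {j₀ : Fin k}

lemma contestedSpeedup_pos (hm : ∀ j, 0 < m j) {c : ℝ} (hc : 0 < c) (l : Fin n) (j : Fin k) :
    0 < contestedSpeedup m l₀ j₀ c l j := by
  have hn : (0 : ℝ) < n := Nat.cast_pos.mpr l.pos
  have hk : (0 : ℝ) < k := Nat.cast_pos.mpr j.pos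
  unfold contestedSpeedup
  apply div_pos _ (hm j)
  split_ifs <;> positivity

lemma sum_mul_contestedSpeedup (hm : ∀ j, 0 < m j) (c : ℝ) (l : Fin n) :
    ∑ j, m j * contestedSpeedup m l₀ j₀ c l j =
      if l = l₀ then c * k + ((k : ℝ) - 1) * c else 1 + ((k : ℝ) - 1) * n := by
  have h : ∀ j, m j * contestedSpeedup m l₀ j₀ c l j =
      if j = j₀ then (if l = l₀ then c * k else 1) else (if l = l₀ then c else (n : ℝ)) := by
    intro j
    unfold contestedSpeedup
    rw [mul_div_cancel₀ _ (hm j).ne']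
    split_ifs <;> rfl
  simp_rw [h]
  rw [Fintype.sum_ite_eq_const, Fintype.card_fin]
  split_ifs <;> rfl

lemma throughput_contestedAllocation (hm : ∀ j, 0 < m j) (c t : ℝ) (l : Fin n) :
    throughput (contestedSpeedup m l₀ j₀ c) (contestedAllocation m l₀ j₀ t) l =
      if l = l₀ then c * k + ((k : ℝ) - 1) * (c * (1 - t))
      else ((k : ℝ) - 1) * (n * (t / ((n : ℝ) - 1))) := by
  have h : ∀ j, contestedSpeedup m l₀ j₀ c l j * contestedAllocation m l₀ j₀ t l j =
      if j = j₀ then (if l = l₀ then c * k else 0)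
      else (if l = l₀ then c * (1 - t) else n * (t / ((n : ℝ) - 1))) := by
    intro j
    unfold contestedSpeedup contestedAllocation
    rw [← mul_assoc, div_mul_cancel₀ _ (hm j).ne']
    split_ifs <;> ring
  unfold throughput dotRow
  simp_rw [h]
  rw [Fintype.sum_ite_eq_const, Fintype.card_fin]
  split_ifs <;> ring

lemma totalEff_contestedAllocation (hn : 2 ≤ n) (hm : ∀ j, 0 < m j) (c t : ℝ) :
    totalEff (contestedSpeedup m l₀ j₀ c) (contestedAllocation m l₀ j₀ t) =
      c * k + ((k : ℝ) - 1) * (c * (1 - t)) + ((k : ℝ) - 1) * n * t := by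
  have hn' : (2 : ℝ) ≤ n := by exact_mod_cast hn
  have hne : (n : ℝ) - 1 ≠ 0 := by linarith
  unfold totalEff
  simp_rw [throughput_contestedAllocation hm]
  rw [Fintype.sum_ite_eq_const, Fintype.card_fin]
  field_simp

lemma feasible_contestedAllocation (hn : 2 ≤ n) (hm : ∀ j, 0 < m j) {t : ℝ}
    (ht₀ : 0 ≤ t) (ht₁ : t ≤ 1) : Feasible m (contestedAllocation m l₀ j₀ t) := by
  have hn' : (2 : ℝ) ≤ n := by exact_mod_cast hn
  have hne : (n : ℝ) - 1 ≠ 0 := by linarith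
  unfold contestedAllocation
  refine ⟨fun l j => mul_nonneg (hm j).le ?_, fun j => ?_⟩
  · have : 0 ≤ t / ((n : ℝ) - 1) := div_nonneg ht₀ (by linarith)
    split_ifs <;> linarith
  · rw [← Finset.mul_sum, Fintype.sum_ite_eq_const, Fintype.card_fin]
    apply le_of_eq
    split_ifs <;> field_simp <;> ring

lemma sharingIncentive_contestedAllocation (hn : 2 ≤ n) (hm : ∀ j, 0 < m j) {c t : ℝ} (hc : 0 ≤ c)
    (ht₁ : t ≤ 1) (ht : ((n : ℝ) - 1) * (1 + ((k : ℝ) - 1) * n) ≤ (n : ℝ) ^ 2 * ((k : ℝ) - 1) * t) :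
    SharingIncentive m (contestedSpeedup m l₀ j₀ c) (contestedAllocation m l₀ j₀ t) := by
  have hn' : (2 : ℝ) ≤ n := by exact_mod_cast hn
  have hk : (1 : ℝ) ≤ k := by exact_mod_cast j₀.pos
  have hn₁ : 0 < (n : ℝ) - 1 := by linarith
  intro l
  rw [sum_mul_contestedSpeedup hm, throughput_contestedAllocation hm, one_div_mul_eq_div,
    div_le_iff₀ (by linarith)]
  split_ifs
  · have h₁ : 0 ≤ ((k : ℝ) - 1) * (c * (1 - t)) * n := by
      have : 0 ≤ (k : ℝ) - 1 := by linarith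
      have : 0 ≤ 1 - t := by linarith
      positivity
    have h₂ : 0 ≤ c * k * (n - 2) :=
      mul_nonneg (mul_nonneg hc (by linarith)) (by linarith)
    nlinarith
  · rw [← sub_nonneg]
    have : ((k : ℝ) - 1) * (n * (t / ((n : ℝ) - 1))) * n - (1 + ((k : ℝ) - 1) * n) =
        ((n : ℝ) ^ 2 * ((k : ℝ) - 1) * t - ((n : ℝ) - 1) * (1 + ((k : ℝ) - 1) * n)) /
          ((n : ℝ) - 1) := by
      field_simp
    rw [this]
    exact div_nonneg (by linarith) hn₁.le

/-- Under any feasible allocation, user `l₀` holds some fraction `a` of type `j₀` and a total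
fraction `b` of the other types, and the other users share at most what is left. -/
lemma Feasible.exists_totalEff_contestedSpeedup_le (hm : ∀ j, 0 < m j)
    {X : Fin n → Fin k → ℝ} (hX : Feasible m X) (c : ℝ) :
    ∃ a b : ℝ, a ≤ 1 ∧ 0 ≤ b ∧
      dotRow (contestedSpeedup m l₀ j₀ 1 l₀) (X l₀) = k * a + b ∧
      totalEff (contestedSpeedup m l₀ j₀ c) X ≤
        c * (k * a + b) + (1 - a) + n * ((k : ℝ) - 1 - b) := by
  have hle : ∀ j, ∑ l ∈ univ.erase l₀, X l j ≤ m j - X l₀ j := fun j => by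
    have h := hX.2 j
    rw [← Finset.add_sum_erase univ _ (mem_univ l₀)] at h
    linarith
  have hrow : ∀ d : ℝ, dotRow (contestedSpeedup m l₀ j₀ d l₀) (X l₀) =
      d * (k * (X l₀ j₀ / m j₀) + ∑ j ∈ univ.erase j₀, X l₀ j / m j) := by
    intro d
    unfold dotRow contestedSpeedup
    rw [← Finset.add_sum_erase univ _ (mem_univ j₀), mul_add, Finset.mul_sum]
    congr 1
    · simp only [if_true]
      ring
    · refine Finset.sum_congr rfl fun j hj => ?_
      rw [if_pos rfl, if_neg (Finset.ne_of_mem_erase hj)]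
      ring
  have hrest : ∑ l ∈ univ.erase l₀, throughput (contestedSpeedup m l₀ j₀ c) X l ≤
      (1 - X l₀ j₀ / m j₀) + n * ((k : ℝ) - 1 - ∑ j ∈ univ.erase j₀, X l₀ j / m j) := by
    calc ∑ l ∈ univ.erase l₀, throughput (contestedSpeedup m l₀ j₀ c) X l
        = ∑ l ∈ univ.erase l₀, ∑ j, (if j = j₀ then 1 else (n : ℝ)) / m j * X l j := by
          refine Finset.sum_congr rfl fun l hl => ?_
          simp [throughput, dotRow, contestedSpeedup, Finset.ne_of_mem_erase hl]
      _ = ∑ j, (if j = j₀ then 1 else (n : ℝ)) / m j * ∑ l ∈ univ.erase l₀, X l j := by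
          rw [Finset.sum_comm]
          simp_rw [Finset.mul_sum]
      _ ≤ ∑ j, (if j = j₀ then 1 else (n : ℝ)) / m j * (m j - X l₀ j) := by
          refine Finset.sum_le_sum fun j _ => mul_le_mul_of_nonneg_left (hle j) ?_
          refine div_nonneg ?_ (hm j).le
          split_ifs <;> positivity
      _ = ∑ j, (if j = j₀ then 1 else (n : ℝ)) * (1 - X l₀ j / m j) := by
          refine Finset.sum_congr rfl fun j _ => ?_
          have := (hm j).ne'
          field_simp
      _ = _ := by
          rw [← Finset.add_sum_erase univ _ (mem_univ j₀), if_pos rfl, one_mul,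
            Finset.sum_congr rfl (g := fun j => (n : ℝ) * (1 - X l₀ j / m j))
              fun j hj => by rw [if_neg (Finset.ne_of_mem_erase hj)],
            ← Finset.mul_sum, Finset.sum_sub_distrib, Finset.sum_const,
            Finset.card_erase_of_mem (mem_univ j₀), nsmul_eq_mul, Finset.card_univ,
            Fintype.card_fin, Nat.cast_sub j₀.pos]
          simp
  refine ⟨X l₀ j₀ / m j₀, ∑ j ∈ univ.erase j₀, X l₀ j / m j, ?_, ?_, ?_, ?_⟩
  · rw [div_le_one (hm j₀)]
    have := Finset.sum_nonneg fun l (_ : l ∈ univ.erase l₀) => hX.1 l j₀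
    linarith [hle j₀]
  · exact Finset.sum_nonneg fun j _ => div_nonneg (hX.1 l₀ j) (hm j).le
  · rw [hrow, one_mul]
  · unfold totalEff
    rw [← Finset.add_sum_erase univ _ (mem_univ l₀), throughput, hrow]
    linarith

end Contested

/-- No mechanism assigning to every positive speedup matrix a feasible
sharing-incentive allocation of maximum total efficiency (among feasible
sharing-incentive allocations) can be strategy-proof. -/
theorem no_efficient_sharingIncentive_strategyProof_mechanism {n k : ℕ}
    (hn : 2 ≤ n) (hk : 2 ≤ k) (m : Fin k → ℝ) (hm : ∀ j, 0 < m j) :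
    ¬ ∃ S : (Fin n → Fin k → ℝ) → (Fin n → Fin k → ℝ),
      (∀ W : Fin n → Fin k → ℝ, (∀ l j, 0 < W l j) →
        Feasible m (S W) ∧ SharingIncentive m W (S W) ∧
          ∀ X : Fin n → Fin k → ℝ, Feasible m X → SharingIncentive m W X →
            totalEff W X ≤ totalEff W (S W)) ∧
      (∀ W : Fin n → Fin k → ℝ, (∀ l j, 0 < W l j) →
        ∀ (l : Fin n) (W' : Fin n → Fin k → ℝ), (∀ i j, 0 < W' i j) →
          (∀ i, i ≠ l → W' i = W i) → (∀ j, W l j ≤ W' l j) →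
          dotRow (W l) (S W' l) ≤ dotRow (W l) (S W l)) := by
  rintro ⟨S, hS, hSP⟩
  have hn' : (2 : ℝ) ≤ n := by exact_mod_cast hn
  have hk' : (2 : ℝ) ≤ k := by exact_mod_cast hk
  let l₀ : Fin n := ⟨0, by omega⟩
  let j₀ : Fin k := ⟨0, by omega⟩
  let W := contestedSpeedup m l₀ j₀
  have hc : (0 : ℝ) < n + 1 := by linarith
  have hW : ∀ l j, 0 < W 1 l j := contestedSpeedup_pos hm one_pos
  have hW' : ∀ l j, 0 < W (n + 1) l j := contestedSpeedup_pos hm hc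
  have honest : dotRow (W 1 l₀) (S (W 1) l₀) ≤ k := by
    obtain ⟨hF, -, hopt⟩ := hS _ hW
    obtain ⟨a, b, ha, hb, hU, htot⟩ :=
      hF.exists_totalEff_contestedSpeedup_le (l₀ := l₀) (j₀ := j₀) hm 1
    have h := (hopt _ (feasible_contestedAllocation hn hm zero_le_one le_rfl)
      (sharingIncentive_contestedAllocation hn hm zero_le_one le_rfl (by nlinarith))).trans htot
    rw [totalEff_contestedAllocation hn hm] at h
    have hb₀ : b ≤ 0 := by
      have : 0 ≤ ((k : ℝ) - 1) * (1 - a) := mul_nonneg (by linarith) (by linarith)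
      nlinarith
    rw [hU]
    nlinarith
  have lying : (k : ℝ) < dotRow (W 1 l₀) (S (W (n + 1)) l₀) := by
    obtain ⟨hF, -, hopt⟩ := hS _ hW'
    obtain ⟨a, b, ha, hb, hU, htot⟩ :=
      hF.exists_totalEff_contestedSpeedup_le (l₀ := l₀) (j₀ := j₀) hm (n + 1)
    have hpos : 0 < (n : ℝ) ^ 2 * ((k : ℝ) - 1) := mul_pos (by positivity) (by linarith)
    obtain ⟨t, ht⟩ : ∃ t : ℝ,
        (n : ℝ) ^ 2 * ((k : ℝ) - 1) * t = ((n : ℝ) - 1) * (1 + ((k : ℝ) - 1) * n) :=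
      ⟨_, mul_div_cancel₀ _ hpos.ne'⟩
    have ht₀ : 0 ≤ t := by
      refine nonneg_of_mul_nonneg_right (?_ : 0 ≤ (n : ℝ) ^ 2 * ((k : ℝ) - 1) * t) hpos
      rw [ht]
      exact mul_nonneg (by linarith) (by nlinarith)
    have ht₁ : t < 1 := by
      refine lt_of_mul_lt_mul_left (?_ : (n : ℝ) ^ 2 * ((k : ℝ) - 1) * t < _ * 1) hpos.le
      rw [ht]
      nlinarith
    have h := (hopt _ (feasible_contestedAllocation hn hm ht₀ ht₁.le)
      (sharingIncentive_contestedAllocation hn hm hc.le ht₁.le ht.ge)).trans htot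
    rw [totalEff_contestedAllocation hn hm] at h
    rw [hU]
    by_contra! hle
    have h₁ : 0 < ((k : ℝ) - 1) * (1 - t) := mul_pos (by linarith) (by linarith)
    have h₂ : k * a + b ≤ (k : ℝ) * (a + n * b) := by
      nlinarith [mul_nonneg hb (by linarith : (0 : ℝ) ≤ k)]
    have h₃ : 0 ≤ (((n : ℝ) + 1) * k - 1) * (k - (k * a + b)) :=
      mul_nonneg (by nlinarith) (by linarith)
    nlinarith
  refine absurd (hSP (W 1) hW l₀ (W (n + 1)) hW' ?_ ?_) (not_le.mpr (honest.trans_lt lying))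
  · intro i hi
    funext j
    simp [W, contestedSpeedup, hi]
  · intro j
    simp only [W, contestedSpeedup, if_true]
    refine div_le_div_of_nonneg_right ?_ (hm j).le
    split_ifs <;> nlinarith
end

section
/- Non-cooperative adjacency: assume each user's speedup row is strictly increasing across types, and assume the users are consistently ordered, i.e. they can be indexed so that for all users i < l and all types p < q one has w_i^p < w_l^p and w_i^q / w_i^p < w_l^q / w_l^p (users with higher absolute speedup also have strictly higher relative speedup on faster types). Then in every optimal solution X of the non-cooperative OEF program, each user is allocated only adjacent GPU types: for every user l, the support {j : x_l^j > 0} is a set of consecutive type indices. -/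
open Finset

/-- All users obtain the same throughput under `X` (w.r.t. `W`). -/
def EqualThroughput {n k : ℕ} (W X : Fin n → Fin k → ℝ) : Prop :=
  ∀ i l, throughput W X i = throughput W X l

/-- At an optimum every device type is fully allocated. -/
theorem sum_eq_of_optimal {n k : ℕ} {m : Fin k → ℝ} {W X : Fin n → Fin k → ℝ}
    (hW : ∀ l j, 0 < W l j) (hfeas : Feasible m X) (heq : EqualThroughput W X)
    (hopt : ∀ Y, Feasible m Y → EqualThroughput W Y → totalEff W Y ≤ totalEff W X)
    (l₀ : Fin n) (j : Fin k) : ∑ l, X l j = m j := by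
  refine le_antisymm (hfeas.2 j) (not_lt.1 fun hlt => ?_)
  have hS : 0 < ∑ l, (W l j)⁻¹ :=
    Finset.sum_pos (fun l _ => inv_pos.2 (hW l j)) ⟨l₀, Finset.mem_univ _⟩
  set δ := (m j - ∑ l, X l j) / ∑ l, (W l j)⁻¹ with hδ
  have hδpos : 0 < δ := div_pos (sub_pos.2 hlt) hS
  let Y : Fin n → Fin k → ℝ := fun l => X l + Pi.single j (δ * (W l j)⁻¹)
  have hY : ∀ l, throughput W Y l = throughput W X l + δ := by
    intro l
    have h1 : W l j ≠ 0 := (hW l j).ne'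
    have h2 : W l j * (δ * (W l j)⁻¹) = δ := by field_simp
    simp [throughput, dotRow, Y, mul_add, Finset.sum_add_distrib, Pi.single_apply, h2]
  have hYfeas : Feasible m Y := by
    refine ⟨fun l i => add_nonneg (hfeas.1 l i) ?_, fun i => ?_⟩
    · rw [Pi.single_apply]
      split_ifs
      exacts [mul_nonneg hδpos.le (inv_pos.2 (hW l j)).le, le_rfl]
    · by_cases hi : i = j
      · subst hi
        simp only [Y, Pi.add_apply, Pi.single_eq_same, Finset.sum_add_distrib,
          ← Finset.mul_sum]
        rw [hδ, div_mul_cancel₀ _ hS.ne']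
        linarith
      · simpa [Y, hi] using hfeas.2 i
  have h := hopt Y hYfeas fun i l => by rw [hY, hY, heq i l]
  have hn : 0 < (n : ℝ) := Nat.cast_pos.2 l₀.pos
  simp only [totalEff, hY, Finset.sum_add_distrib, Finset.sum_const, Finset.card_univ,
    Fintype.card_fin, nsmul_eq_mul] at h
  linarith [mul_pos hn hδpos]

/-- At an optimum no two users can gain by trading: a user `a` holding type `s` has no comparative
advantage on a type `q` over a user `b` holding `q`. -/
theorem mul_le_mul_of_optimal {n k : ℕ} {m : Fin k → ℝ} {W X : Fin n → Fin k → ℝ}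
    (hW : ∀ l j, 0 < W l j) (hfeas : Feasible m X) (heq : EqualThroughput W X)
    (hopt : ∀ Y, Feasible m Y → EqualThroughput W Y → totalEff W Y ≤ totalEff W X)
    {a b : Fin n} (hab : a ≠ b) {s q : Fin k} (hsq : s ≠ q)
    (ha : 0 < X a s) (hb : 0 < X b q) : W a q * W b s ≤ W a s * W b q := by
  by_contra! hlt
  have has := hW a s
  have haq := hW a q
  have hbs := hW b s
  have hbq := hW b q
  set α := W a q / W a s with hα
  set β := W b q / W b s with hβ
  have hαpos : 0 < α := div_pos haq has
  have hβpos : 0 < β := div_pos hbq hbs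
  have hβα : β < α := by
    rw [hα, hβ, div_lt_div_iff₀ hbs has]
    linarith
  have hWα : W a s * α = W a q := mul_div_cancel₀ _ has.ne'
  have hWβ : W b s * β = W b q := mul_div_cancel₀ _ hbs.ne'
  obtain ⟨δ, hδpos, hδb, hδa⟩ : ∃ δ : ℝ, 0 < δ ∧ δ ≤ X b q ∧ δ * α ≤ X a s :=
    ⟨min (X b q) (X a s / α), lt_min hb (div_pos ha hαpos), min_le_left _ _,
      (le_div_iff₀ hαpos).1 (min_le_right _ _)⟩
  let Y : Fin n → Fin k → ℝ := X +
    (Pi.single a (Pi.single q δ - Pi.single s (δ * α)) +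
      Pi.single b (Pi.single s (δ * β) - Pi.single q δ))
  have hYa : Y a = X a + (Pi.single q δ - Pi.single s (δ * α)) := by simp [Y, hab]
  have hYb : Y b = X b + (Pi.single s (δ * β) - Pi.single q δ) := by simp [Y, hab.symm]
  have hYl : ∀ l, l ≠ a → l ≠ b → Y l = X l := fun l h₁ h₂ => by simp [Y, h₁, h₂]
  have hthr : ∀ l, throughput W Y l = throughput W X l := by
    intro l
    unfold throughput dotRow
    by_cases h₁ : l = a
    · subst h₁
      simp only [hYa, Pi.add_apply, Pi.sub_apply, Pi.single_apply, mul_add, mul_sub,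
        Finset.sum_add_distrib, Finset.sum_sub_distrib, mul_ite, mul_zero, Finset.sum_ite_eq',
        Finset.mem_univ, if_true]
      linear_combination (-δ) * hWα
    · by_cases h₂ : l = b
      · subst h₂
        simp only [hYb, Pi.add_apply, Pi.sub_apply, Pi.single_apply, mul_add, mul_sub,
          Finset.sum_add_distrib, Finset.sum_sub_distrib, mul_ite, mul_zero, Finset.sum_ite_eq',
          Finset.mem_univ, if_true]
        linear_combination δ * hWβ
      · rw [hYl l h₁ h₂]
  have hsum : ∀ j, ∑ l, Y l j = ∑ l, X l j - (if j = s then δ * (α - β) else 0) := by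
    intro j
    have hsingle : ∀ (c : Fin n) (v : Fin k → ℝ),
        ∑ l, (Pi.single c v : Fin n → Fin k → ℝ) l j = v j := fun c v => by
      rw [← Finset.sum_apply, Fintype.sum_pi_single']
    simp only [Y, Pi.add_apply, Finset.sum_add_distrib, hsingle, Pi.sub_apply]
    simp only [Pi.single_apply]
    split_ifs <;> ring
  have hgain : 0 < δ * (α - β) := mul_pos hδpos (sub_pos.2 hβα)
  have hYfeas : Feasible m Y := by
    refine ⟨fun l j => ?_, fun j => ?_⟩
    · have hX := hfeas.1 l j
      by_cases h₁ : l = a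
      · subst h₁
        rw [hYa]
        simp only [Pi.add_apply, Pi.sub_apply, Pi.single_apply]
        split_ifs with h₃ h₄ h₄ <;> subst_vars <;> first | exact absurd rfl hsq | linarith
      · by_cases h₂ : l = b
        · subst h₂
          rw [hYb]
          have := mul_pos hδpos hβpos
          simp only [Pi.add_apply, Pi.sub_apply, Pi.single_apply]
          split_ifs with h₃ h₄ h₄ <;> subst_vars <;> first | exact absurd rfl hsq | linarith
        · rwa [hYl l h₁ h₂]
    · rw [hsum]
      have := hfeas.2 j
      split_ifs <;> linarith
  have hYeff : totalEff W Y = totalEff W X := Finset.sum_congr rfl fun l _ => hthr l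
  have hfull := sum_eq_of_optimal hW hYfeas (fun i l => by rw [hthr, hthr, heq i l])
    (fun Z hZ hZeq => hYeff ▸ hopt Z hZ hZeq) a s
  rw [hsum, if_pos rfl] at hfull
  linarith [hfeas.2 s]

/-- Non-cooperative adjacency: if every user's speedup row is strictly increasing
across types and users are consistently ordered, then in every optimal solution
of the non-cooperative OEF program (maximize total efficiency over feasible
allocations with equal throughputs) the support of each user's allocation row is
a set of consecutive type indices. -/
theorem noncooperative_adjacent_types {n k : ℕ}
    (m : Fin k → ℝ) (hm : ∀ j, 0 < m j)
    (W : Fin n → Fin k → ℝ) (hW : ∀ l j, 0 < W l j)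
    (hrow : ∀ l, StrictMono (W l))
    (horder : ∀ i l : Fin n, i < l → ∀ p q : Fin k, p < q →
      W i p < W l p ∧ W i q / W i p < W l q / W l p)
    (X : Fin n → Fin k → ℝ)
    (hfeas : Feasible m X) (heq : EqualThroughput W X)
    (hopt : ∀ Y, Feasible m Y → EqualThroughput W Y → totalEff W Y ≤ totalEff W X) :
    ∀ (l : Fin n) (p q r : Fin k), p ≤ q → q ≤ r → 0 < X l p → 0 < X l r →
      0 < X l q := by
  intro l p q r hpq hqr hp hr
  rcases hpq.eq_or_lt with rfl | hpq
  · exact hp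
  rcases hqr.eq_or_lt with rfl | hqr
  · exact hr
  have hpos : 0 < ∑ i, X i q := by
    rw [sum_eq_of_optimal hW hfeas heq hopt l q]
    exact hm q
  obtain ⟨i, -, hi⟩ := Finset.exists_lt_of_sum_lt
    (s := Finset.univ) (f := fun _ : Fin n => (0 : ℝ)) (g := fun i => X i q) (by simpa using hpos)
  rcases lt_trichotomy i l with hil | rfl | hil
  · have h := mul_le_mul_of_optimal hW hfeas heq hopt hil.ne' hpq.ne hp hi
    have h' := (horder i l hil p q hpq).2
    rw [div_lt_div_iff₀ (hW i p) (hW l p)] at h'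
    linarith
  · exact hi
  · have h := mul_le_mul_of_optimal hW hfeas heq hopt hil.ne hqr.ne' hr hi
    have h' := (horder l i hil q r hqr).2
    rw [div_lt_div_iff₀ (hW l q) (hW i q)] at h'
    linarith
end

section
/- Strategy-proofness of non-cooperative OEF: let W be a speedup matrix whose rows are strictly increasing across types and consistently ordered (for users i < l and types p < q: w_i^p < w_l^p and w_i^q/w_i^p < w_l^q/w_l^p), and let W' agree with W except in row i, where W'_i ≥ W_i componentwise (and W' also satisfies the same structural hypotheses). If X is an optimal solution of the non-cooperative OEF program for the true matrix W and X' is an optimal solution of the non-cooperative OEF program for the reported matrix W', then user i's true throughput does not increase by misreporting: W_i·x'_i ≤ W_i·x_i. -/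
open Finset

lemma dotRow_smul {k : ℕ} (w x : Fin k → ℝ) (c : ℝ) :
    dotRow w (fun j => c * x j) = c * dotRow w x := by
  simp only [dotRow, Finset.mul_sum]
  exact Finset.sum_congr rfl fun j _ => by ring

lemma totalEff_of_throughput_eq {n k : ℕ} {W X : Fin n → Fin k → ℝ} {t : ℝ}
    (h : ∀ l, throughput W X l = t) : totalEff W X = n * t := by
  simp [totalEff, h]

/-- Scaling down the rows of a feasible allocation keeps it feasible. -/
lemma Feasible.scale {n k : ℕ} {m : Fin k → ℝ} {X : Fin n → Fin k → ℝ}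
    (hX : Feasible m X) {s : Fin n → ℝ} (h0 : ∀ l, 0 ≤ s l) (h1 : ∀ l, s l ≤ 1) :
    Feasible m (fun l j => s l * X l j) :=
  ⟨fun l j => mul_nonneg (h0 l) (hX.1 l j), fun j =>
    (Finset.sum_le_sum fun l _ => mul_le_of_le_one_left (hX.1 l j) (h1 l)).trans (hX.2 j)⟩

/-- Strategy-proofness of non-cooperative OEF: if `W'` agrees with the true
matrix `W` except that user `i` inflates their own row, and both matrices have
strictly increasing, consistently ordered rows, then user `i`'s true throughput
under an optimal non-cooperative OEF allocation for `W'` is no larger than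
under one for `W`. -/
theorem noncooperative_strategyProof {n k : ℕ}
    (m : Fin k → ℝ) (hm : ∀ j, 0 < m j)
    (W W' : Fin n → Fin k → ℝ)
    (hW : ∀ l j, 0 < W l j) (hW' : ∀ l j, 0 < W' l j)
    (hrow : ∀ l, StrictMono (W l)) (hrow' : ∀ l, StrictMono (W' l))
    (horder : ∀ i l : Fin n, i < l → ∀ p q : Fin k, p < q →
      W i p < W l p ∧ W i q / W i p < W l q / W l p)
    (horder' : ∀ i l : Fin n, i < l → ∀ p q : Fin k, p < q →
      W' i p < W' l p ∧ W' i q / W' i p < W' l q / W' l p)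
    (i : Fin n)
    (hagree : ∀ l, l ≠ i → W' l = W l)
    (hge : ∀ j, W i j ≤ W' i j)
    (X X' : Fin n → Fin k → ℝ)
    (hXfeas : Feasible m X) (hXeq : EqualThroughput W X)
    (hXopt : ∀ Y, Feasible m Y → EqualThroughput W Y → totalEff W Y ≤ totalEff W X)
    (hX'feas : Feasible m X') (hX'eq : EqualThroughput W' X')
    (hX'opt : ∀ Y, Feasible m Y → EqualThroughput W' Y →
      totalEff W' Y ≤ totalEff W' X') :
    dotRow (W i) (X' i) ≤ dotRow (W i) (X i) := by
  set c := dotRow (W i) (X' i) with hc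
  set t := throughput W' X' i with ht
  have hc0 : 0 ≤ c := Finset.sum_nonneg fun j _ => mul_nonneg (hW i j).le (hX'feas.1 i j)
  have hct : c ≤ t :=
    Finset.sum_le_sum fun j _ => mul_le_mul_of_nonneg_right (hge j) (hX'feas.1 i j)
  -- Scale the other users down to the true throughput of user `i` under `X'`.
  let s : Fin n → ℝ := fun l => if l = i then 1 else c / t
  have hs0 : ∀ l, 0 ≤ s l := fun l => by
    by_cases hl : l = i
    · simp [s, hl]
    · simpa [s, hl] using div_nonneg hc0 (hc0.trans hct)
  have hs1 : ∀ l, s l ≤ 1 := fun l => by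
    by_cases hl : l = i
    · simp [s, hl]
    · simpa [s, hl] using div_le_one_of_le₀ hct (hc0.trans hct)
  have hY : ∀ l, throughput W (fun l j => s l * X' l j) l = c := fun l => by
    rw [throughput, dotRow_smul]
    by_cases hl : l = i
    · simp [s, hl, hc]
    · have h : dotRow (W l) (X' l) = t := by
        rw [← hagree l hl]
        exact hX'eq l i
      rw [h]
      simp only [s, hl, if_false]
      exact div_mul_cancel_of_imp fun h0 => le_antisymm (h0 ▸ hct) hc0
  have key := hXopt _ (hX'feas.scale hs0 hs1) fun a b => (hY a).trans (hY b).symm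
  rw [totalEff_of_throughput_eq hY, totalEff_of_throughput_eq fun l => hXeq l i] at key
  have hn : (0 : ℝ) < n := by exact_mod_cast i.pos
  exact le_of_mul_le_mul_left key hn
end

section
/- Cheaters are penalized when honest users lose: let W be a speedup matrix and W' a matrix agreeing with W except in row i, with W'_i ≥ W_i componentwise. Suppose the nonnegative allocation X satisfies the equal-throughput constraints for W (w_l·x_l = w_{l'}·x_{l'} for all users l, l') and the nonnegative allocation X' satisfies the equal-throughput constraints for W' (W'_l·x'_l equal across all users l). If some honest user h ≠ i has strictly smaller throughput under X' than under X, i.e. w_h·x'_h < w_h·x_h, then user i's true throughput strictly decreases as well: w_i·x'_i < w_i·x_i. -/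
open Finset

/-- Throughput on a nonnegative allocation row is monotone in the speedup row. -/
lemma dotRow_le_dotRow {k : ℕ} {w w' x : Fin k → ℝ} (hw : ∀ j, w j ≤ w' j)
    (hx : ∀ j, 0 ≤ x j) : dotRow w x ≤ dotRow w' x :=
  Finset.sum_le_sum fun j _ => mul_le_mul_of_nonneg_right (hw j) (hx j)

/-- Cheaters are penalized when honest users lose: if `X` equalizes throughputs
w.r.t. the true matrix `W` and `X'` equalizes throughputs w.r.t. the reported
matrix `W'` (which agrees with `W` except that user `i` inflated their row),
and some honest user strictly loses throughput, then the cheating user `i`'s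
true throughput strictly decreases as well. -/
theorem cheater_penalized {n k : ℕ}
    (W W' : Fin n → Fin k → ℝ)
    (hW : ∀ l j, 0 < W l j) (hW' : ∀ l j, 0 < W' l j)
    (i : Fin n)
    (hagree : ∀ l, l ≠ i → W' l = W l)
    (hge : ∀ j, W i j ≤ W' i j)
    (X X' : Fin n → Fin k → ℝ)
    (hXnn : ∀ l j, 0 ≤ X l j) (hX'nn : ∀ l j, 0 ≤ X' l j)
    (hXeq : EqualThroughput W X) (hX'eq : EqualThroughput W' X')
    (h : Fin n) (hhi : h ≠ i)
    (hloss : dotRow (W h) (X' h) < dotRow (W h) (X h)) :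
    dotRow (W i) (X' i) < dotRow (W i) (X i) := by
  have hX' := hX'eq i h
  have hX := hXeq i h
  simp only [throughput, hagree h hhi] at hX' hX
  calc dotRow (W i) (X' i) ≤ dotRow (W' i) (X' i) := dotRow_le_dotRow hge (hX'nn i)
    _ = dotRow (W h) (X' h) := hX'
    _ < dotRow (W h) (X h) := hloss
    _ = dotRow (W i) (X i) := hX.symm
end

section
/- Sparsity of extreme points of the OEF feasible polytope: fix a positive speedup matrix W ∈ ℝ^{n×k} and device counts m_j > 0, and let P = { X ∈ ℝ^{n×k} : x_l^j ≥ 0 for all l, j; ∑_{l=1}^n x_l^j = m_j for every type j; and w_l·x_l = w_1·x_1 for every user l }. Then every extreme point of P has at most n + k − 1 nonzero entries. -/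
open Finset

lemma exists_ne_zero_map_eq_zero_of_finrank_lt_card {ι E : Type*} [Fintype ι]
    [AddCommGroup E] [Module ℝ E] [FiniteDimensional ℝ E]
    (L : (ι → ℝ) →ₗ[ℝ] E) (S : Finset ι) (h : Module.finrank ℝ E < S.card) :
    ∃ v : ι → ℝ, v ≠ 0 ∧ L v = 0 ∧ ∀ i ∉ S, v i = 0 := by
  let e : (S → ℝ) →ₗ[ℝ] (ι → ℝ) := Function.ExtendByZero.linearMap ℝ Subtype.val
  have he : ∀ (u : S → ℝ) (i : S), e u i = u i := fun u i =>
    Subtype.val_injective.extend_apply u 0 i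
  have hker : LinearMap.ker (L ∘ₗ e) ≠ ⊥ :=
    LinearMap.ker_ne_bot_of_finrank_lt (by simpa using h)
  obtain ⟨u, hu, hu0⟩ := (Submodule.ne_bot_iff _).1 hker
  refine ⟨e u, fun h0 => hu0 ?_, by simpa using hu, fun i hi => ?_⟩
  · ext i
    rw [← he u i, h0]
    rfl
  · exact Function.extend_apply' _ _ _ (by rintro ⟨a, rfl⟩; exact hi a.2)

lemma exists_pos_mul_abs_le {ι : Type*} [Finite ι] {x v : ι → ℝ}
    (hx : ∀ i, 0 ≤ x i) (hv : ∀ i, x i = 0 → v i = 0) :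
    ∃ ε > 0, ∀ i, ε * |v i| ≤ x i := by
  have hev : ∀ᶠ ε : ℝ in nhdsWithin 0 (Set.Ioi 0), ∀ i, ε * |v i| ≤ x i := by
    refine Filter.eventually_all.2 fun i => ?_
    rcases (hx i).eq_or_lt with h0 | hpos
    · simp [hv i h0.symm, hx i]
    · have ht : Filter.Tendsto (fun ε : ℝ => ε * |v i|) (nhds 0) (nhds (0 * |v i|)) :=
        (continuous_id.mul continuous_const).tendsto 0
      rw [zero_mul] at ht
      filter_upwards [(ht.mono_left nhdsWithin_le_nhds).eventually_lt_const hpos] with ε hε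
      exact hε.le
  obtain ⟨ε, h, hε⟩ := (hev.and self_mem_nhdsWithin).exists
  exact ⟨ε, hε, h⟩

lemma throughput_add_smul {n k : ℕ} (W X D : Fin n → Fin k → ℝ) (c : ℝ) (l : Fin n) :
    throughput W (X + c • D) l = throughput W X l + c * throughput W D l := by
  simp only [throughput, dotRow, Pi.add_apply, Pi.smul_apply, smul_eq_mul, mul_sum,
    ← sum_add_distrib]
  exact sum_congr rfl fun j _ => by ring

lemma exists_balanced_direction {n k : ℕ} (hn : 0 < n) (W : Fin n → Fin k → ℝ)
    (S : Finset (Fin n × Fin k)) (hS : n + k - 1 < S.card) :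
    ∃ D : Fin n → Fin k → ℝ, D ≠ 0 ∧ (∀ j, ∑ l, D l j = 0) ∧
      (∀ l, throughput W D l = throughput W D ⟨0, hn⟩) ∧
      ∀ l j, (l, j) ∉ S → D l j = 0 := by
  let T : Fin n → (Fin n × Fin k → ℝ) →ₗ[ℝ] ℝ := fun l =>
    ∑ j, W l j • LinearMap.proj (l, j)
  let L : (Fin n × Fin k → ℝ) →ₗ[ℝ] (Fin k → ℝ) × ({l : Fin n // l ≠ ⟨0, hn⟩} → ℝ) :=
    (LinearMap.pi fun j => ∑ l, LinearMap.proj (l, j)).prod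
      (LinearMap.pi fun l => T l - T ⟨0, hn⟩)
  obtain ⟨v, hv0, hLv, hvS⟩ := exists_ne_zero_map_eq_zero_of_finrank_lt_card L S (by
    simp only [Module.finrank_prod, Module.finrank_fintype_fun_eq_card, Fintype.card_fin,
      ne_eq, Fintype.card_subtype_compl, Fintype.card_unique]
    omega)
  have hT : ∀ l, throughput W (fun l j => v (l, j)) l = T l v := fun l => by
    simp [throughput, dotRow, T]
  refine ⟨fun l j => v (l, j), fun h => hv0 ?_, fun j => ?_, fun l => ?_,
    fun l j h => hvS _ h⟩
  · ext p
    exact congrFun (congrFun h p.1) p.2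
  · simpa [L] using congrFun (congrArg Prod.fst hLv) j
  · rw [hT, hT]
    by_cases hl : l = ⟨0, hn⟩
    · rw [hl]
    · exact sub_eq_zero.1 (congrFun (congrArg Prod.snd hLv) ⟨l, hl⟩)

/-- Every extreme point of the polytope of nonnegative allocations that fully
allocate all devices and equalize all users' throughputs (with user 1, i.e.
index 0) has at most `n + k - 1` nonzero entries. -/
theorem extremePoint_sparsity {n k : ℕ} (hn : 0 < n)
    (m : Fin k → ℝ) (hm : ∀ j, 0 < m j)
    (W : Fin n → Fin k → ℝ) (hW : ∀ l j, 0 < W l j) :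
    ∀ X ∈ Set.extremePoints ℝ
      {X : Fin n → Fin k → ℝ | (∀ l j, 0 ≤ X l j) ∧ (∀ j, ∑ l, X l j = m j) ∧
        ∀ l, throughput W X l = throughput W X ⟨0, hn⟩},
      (Finset.univ.filter fun p : Fin n × Fin k => X p.1 p.2 ≠ 0).card
        ≤ n + k - 1 := by
  rintro X ⟨⟨hX0, hXm, hXW⟩, hext⟩
  by_contra! hcard
  obtain ⟨D, hD0, hDm, hDW, hDS⟩ := exists_balanced_direction hn W _ hcard
  obtain ⟨ε, hε, hle⟩ := exists_pos_mul_abs_le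
    (x := fun p : Fin n × Fin k => X p.1 p.2) (v := fun p => D p.1 p.2)
    (fun p => hX0 p.1 p.2) (fun p hp => hDS p.1 p.2 (by simpa using hp))
  have hmem : ∀ c : ℝ, |c| = ε → X + c • D ∈
      {X : Fin n → Fin k → ℝ | (∀ l j, 0 ≤ X l j) ∧ (∀ j, ∑ l, X l j = m j) ∧
        ∀ l, throughput W X l = throughput W X ⟨0, hn⟩} := by
    refine fun c hc => ⟨fun l j => ?_, fun j => ?_, fun l => ?_⟩
    · have h1 := hle (l, j)
      rw [← hc, ← abs_mul] at h1
      have h2 := neg_abs_le (c * D l j)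
      simp only [Pi.add_apply, Pi.smul_apply, smul_eq_mul]
      linarith
    · simp [sum_add_distrib, ← mul_sum, hDm, hXm]
    · rw [throughput_add_smul, throughput_add_smul, hXW l, hDW l]
  have hseg : X ∈ openSegment ℝ (X + ε • D) (X + (-ε) • D) :=
    ⟨1 / 2, 1 / 2, by norm_num, by norm_num, by norm_num, by module⟩
  have heq := hext (hmem ε (abs_of_pos hε)) (hmem (-ε) (by rw [abs_neg, abs_of_pos hε])) hseg
  exact hD0 ((smul_eq_zero.1 (add_eq_left.1 heq)).resolve_left hε.ne')
end

section
/- Pure efficiency maximization is unfair: let n = 3 users share k = 2 GPU types with m = (1, 1) device each, and speedup matrix W with rows w_1 = (1, 2), w_2 = (1, 3), w_3 = (1, 4). Then: (i) the maximum total efficiency over feasible allocations equals 5; (ii) every feasible allocation attaining total efficiency 5 satisfies x_1^2 = x_2^2 = 0 and x_3^2 = 1; consequently (iii) in every such allocation at least one of users 1 and 2 obtains throughput at most 1/2, so the allocation is neither sharing-incentive (user 1's and user 2's sharing-incentive thresholds are 1 and 4/3) nor envy-free (that user envies user 3, whose allocation would give them throughput at least 2). -/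
open Finset

/-- Pure efficiency maximization is unfair: with 3 users, 2 GPU types with one
device each, and speedup rows (1,2), (1,3), (1,4): (i) the maximum total
efficiency over feasible allocations is 5; (ii) any feasible allocation
attaining it gives type 2 entirely to user 3; hence (iii) some user among the
first two gets throughput at most 1/2 (while their sharing-incentive thresholds
are 1 and 4/3, and user 3's allocation would give them throughput at least 2),
so the allocation is neither sharing-incentive nor envy-free. -/
theorem pure_efficiency_maximization_unfair
    (W : Fin 3 → Fin 2 → ℝ) (hWdef : W = ![![1, 2], ![1, 3], ![1, 4]])
    (m : Fin 2 → ℝ) (hmdef : m = ![1, 1]) :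
    IsGreatest {t : ℝ | ∃ X : Fin 3 → Fin 2 → ℝ, Feasible m X ∧ totalEff W X = t} 5 ∧
    ((1 / (3 : ℝ)) * ∑ j, m j * W 0 j = 1 ∧ (1 / (3 : ℝ)) * ∑ j, m j * W 1 j = 4 / 3) ∧
    ∀ X : Fin 3 → Fin 2 → ℝ, Feasible m X → totalEff W X = 5 →
      (X 0 1 = 0 ∧ X 1 1 = 0 ∧ X 2 1 = 1) ∧
      (∃ l : Fin 3, (l = 0 ∨ l = 1) ∧ throughput W X l ≤ 1 / 2 ∧
        2 ≤ dotRow (W l) (X 2) ∧ throughput W X l < dotRow (W l) (X 2)) ∧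
      ¬ SharingIncentive m W X ∧ ¬ EnvyFree W X := by
  subst hWdef hmdef
  refine ⟨⟨⟨![![0, 0], ![0, 0], ![1, 1]], ⟨?_, ?_⟩, ?_⟩, ?_⟩, ⟨?_, ?_⟩, ?_⟩
  · intro l j
    fin_cases l <;> fin_cases j <;> simp
  · intro j
    fin_cases j <;> simp [Fin.sum_univ_succ]
  · norm_num [totalEff, throughput, dotRow, Fin.sum_univ_succ]
  · rintro t ⟨X, ⟨hnonneg, hcap⟩, rfl⟩
    have h0 := hcap 0
    have h1 := hcap 1
    have := hnonneg 0 1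
    have := hnonneg 1 1
    simp [totalEff, throughput, dotRow, Fin.sum_univ_three, Fin.sum_univ_two] at *
    linarith
  · norm_num [Fin.sum_univ_two]
  · norm_num [Fin.sum_univ_two]
  · rintro X ⟨hnonneg, hcap⟩ htotal
    have h0 := hcap 0
    have h1 := hcap 1
    have p00 := hnonneg 0 0
    have p10 := hnonneg 1 0
    have p20 := hnonneg 2 0
    have p01 := hnonneg 0 1
    have p11 := hnonneg 1 1
    simp only [totalEff, throughput, dotRow, Fin.sum_univ_three, Fin.sum_univ_two,
      Matrix.cons_val, one_mul] at h0 h1 htotal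
    have e01 : X 0 1 = 0 := by linarith
    have e11 : X 1 1 = 0 := by linarith
    have e21 : X 2 1 = 1 := by linarith
    have unfair : ∃ l : Fin 3, (l = 0 ∨ l = 1) ∧
        throughput ![![1, 2], ![1, 3], ![1, 4]] X l ≤ 1 / 2 ∧
        2 ≤ dotRow (![![1, 2], ![1, 3], ![1, 4]] l) (X 2) ∧
        throughput ![![1, 2], ![1, 3], ![1, 4]] X l <
          dotRow (![![1, 2], ![1, 3], ![1, 4]] l) (X 2) := by
      rcases le_total (X 0 0) (1 / 2) with h | h
      · refine ⟨0, Or.inl rfl, ?_, ?_, ?_⟩ <;>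
          simp only [throughput, dotRow, Fin.sum_univ_two, Matrix.cons_val, e01, e21] <;>
          linarith
      · refine ⟨1, Or.inr rfl, ?_, ?_, ?_⟩ <;>
          simp only [throughput, dotRow, Fin.sum_univ_two, Matrix.cons_val, e11, e21] <;>
          linarith
    refine ⟨⟨e01, e11, e21⟩, unfair, fun hshare => ?_, fun henvy => ?_⟩
    · obtain ⟨l, rfl | rfl, hhalf, -⟩ := unfair
      · have hl := (hshare 0).trans hhalf
        norm_num [Fin.sum_univ_two] at hl
      · have hl := (hshare 1).trans hhalf
        norm_num [Fin.sum_univ_two] at hl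
    · obtain ⟨l, -, -, -, hlt⟩ := unfair
      exact (henvy l 2).not_gt hlt
end

section
/- Optimal envy-free allocation for a two-user instance: let n = 2 users share k = 2 GPU types with m = (1, 1) device each, and speedup matrix W with rows w_1 = (1, 2), w_2 = (1, 5). Then the allocation X with rows x_1 = (1, 1/4), x_2 = (0, 3/4) is feasible and envy-free, its total efficiency is 21/4, and 21/4 is the maximum total efficiency over all feasible envy-free allocations for W. -/
open Finset

/-- Optimal envy-free allocation for the two-user instance with speedup rows
(1,2) and (1,5) and one device of each of the two types: the allocation with
rows (1, 1/4) and (0, 3/4) is feasible and envy-free, has total efficiency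
21/4, and 21/4 is the maximum total efficiency over feasible envy-free
allocations. -/
theorem optimal_envyFree_two_user_instance
    (W : Fin 2 → Fin 2 → ℝ) (hWdef : W = ![![1, 2], ![1, 5]])
    (m : Fin 2 → ℝ) (hmdef : m = ![1, 1])
    (X : Fin 2 → Fin 2 → ℝ) (hXdef : X = ![![1, 1 / 4], ![0, 3 / 4]]) :
    Feasible m X ∧ EnvyFree W X ∧ totalEff W X = 21 / 4 ∧
    ∀ Y : Fin 2 → Fin 2 → ℝ, Feasible m Y → EnvyFree W Y →
      totalEff W Y ≤ 21 / 4 := by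
  subst hWdef hmdef hXdef
  refine ⟨⟨fun l j => ?_, fun j => ?_⟩, fun l i => ?_, ?_, fun Y ⟨hnonneg, hcap⟩ hEF => ?_⟩
  · fin_cases l <;> fin_cases j <;> norm_num
  · fin_cases j <;> norm_num [Fin.sum_univ_two]
  · fin_cases l <;> fin_cases i <;> norm_num [dotRow, Fin.sum_univ_two]
  · norm_num [totalEff, throughput, dotRow, Fin.sum_univ_two]
  · have hcap₀ := hcap 0
    have hcap₁ := hcap 1
    have henvy := hEF 0 1
    have hY := hnonneg 1 0
    simp [totalEff, throughput, dotRow, Fin.sum_univ_two] at hcap₀ hcap₁ henvy ⊢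
    linarith
end

section
/- Profitable misreporting under envy-free efficiency maximization: let n = 2 users share k = 2 GPU types with m = (1, 1) device each, true speedup matrix W with rows w_1 = (1, 2), w_2 = (1, 5), and reported matrix W^l with rows (1, 4), (1, 5) (user 1 inflates their speedup on type 2). Then: (i) the allocation X^l with rows (1, 3/8), (0, 5/8) is feasible, envy-free with respect to W^l, and attains the maximum W^l-total efficiency 45/8 over feasible W^l-envy-free allocations; (ii) under the true matrix W, user 1's throughput under X^l is 7/4, which exceeds the throughput 3/2 user 1 receives under the truthful optimal envy-free allocation with rows (1, 1/4), (0, 3/4); and (iii) the true total efficiency of X^l is 39/8, which is strictly less than the truthful optimum 21/4. -/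
open Finset

/-- Profitable misreporting under envy-free efficiency maximization: with true
speedup rows (1,2), (1,5) and reported rows (1,4), (1,5), (i) the allocation
with rows (1, 3/8), (0, 5/8) is feasible, envy-free w.r.t. the reported matrix,
and attains the maximum reported-matrix total efficiency 45/8 among feasible
reported-matrix-envy-free allocations; (ii) user 1's true throughput under it is
7/4, exceeding the 3/2 obtained under the truthful optimal envy-free allocation
with rows (1, 1/4), (0, 3/4); and (iii) its true total efficiency is 39/8,
strictly below the truthful optimum 21/4. -/
theorem profitable_misreporting_envyFree
    (W Wl : Fin 2 → Fin 2 → ℝ)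
    (hWdef : W = ![![1, 2], ![1, 5]]) (hWldef : Wl = ![![1, 4], ![1, 5]])
    (m : Fin 2 → ℝ) (hmdef : m = ![1, 1])
    (Xl X : Fin 2 → Fin 2 → ℝ)
    (hXldef : Xl = ![![1, 3 / 8], ![0, 5 / 8]])
    (hXdef : X = ![![1, 1 / 4], ![0, 3 / 4]]) :
    (Feasible m Xl ∧ EnvyFree Wl Xl ∧ totalEff Wl Xl = 45 / 8 ∧
      ∀ Y : Fin 2 → Fin 2 → ℝ, Feasible m Y → EnvyFree Wl Y →
        totalEff Wl Y ≤ 45 / 8) ∧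
    (Feasible m X ∧ EnvyFree W X ∧
      (∀ Y : Fin 2 → Fin 2 → ℝ, Feasible m Y → EnvyFree W Y →
        totalEff W Y ≤ totalEff W X) ∧
      dotRow (W 0) (Xl 0) = 7 / 4 ∧ dotRow (W 0) (X 0) = 3 / 2 ∧
      dotRow (W 0) (X 0) < dotRow (W 0) (Xl 0)) ∧
    (totalEff W Xl = 39 / 8 ∧ totalEff W Xl < 21 / 4) := by
  subst hWdef hWldef hmdef hXldef hXdef
  refine ⟨⟨?_, ?_, ?_, ?_⟩, ⟨?_, ?_, ?_, ?_, ?_, ?_⟩, ?_, ?_⟩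
  · simp [Feasible, Fin.forall_fin_two, Fin.sum_univ_two]
    norm_num
  · simp [EnvyFree, dotRow, Fin.forall_fin_two, Fin.sum_univ_two]
    norm_num
  · simp [totalEff, throughput, dotRow, Fin.sum_univ_two]
    norm_num
  · intro Y hF hE
    have h₀ := hF.1 1 0
    have c₀ := hF.2 0
    have c₁ := hF.2 1
    have e := hE 0 1
    simp [totalEff, throughput, dotRow, Fin.sum_univ_two] at *
    linarith
  · simp [Feasible, Fin.forall_fin_two, Fin.sum_univ_two]
    norm_num
  · simp [EnvyFree, dotRow, Fin.forall_fin_two, Fin.sum_univ_two]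
    norm_num
  · intro Y hF hE
    have h₀ := hF.1 1 0
    have c₀ := hF.2 0
    have c₁ := hF.2 1
    have e := hE 0 1
    simp [totalEff, throughput, dotRow, Fin.sum_univ_two] at *
    linarith
  all_goals
    simp [totalEff, throughput, dotRow, Fin.sum_univ_two]
    norm_num
end
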